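/- arXiv:2501.15243 — 2 statements merged into one kernel-verified Lean document; each statement's English description precedes it below -/
import Mathlib

section
/- Let n ≥ 3 and let K : ℝⁿ × (0,∞) → ℝ satisfy |K(x,t)| ≤ C|x|^{-α} t^{-β/2} for all α,β ≥ 0 with α+β = n, and let G : ℝⁿ × (0,∞) → ℝ satisfy |G(y,s)| ≤ C(1+|y|)^{-a}(1+s)^{-b/2} for all a,b ≥ 0 with a+b = n+1. Fix ε ∈ (0,1). Then the spacetime convolution I(x,t) = ∫₀ᵗ∫_{ℝⁿ} K(x-y,t-s) G(y,s) dy ds satisfies the spatial bound |I(x,t)| ≤ C'(1+|x|)^{-(n-1)} uniformly in t > 0, with C' depending only on C, n, ε. -/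
open MeasureTheory

/-- The radial profile used to dominate the spatial convolution. -/
noncomputable def prof (g : ℝ) (r : ℝ) : ℝ := if r ≤ 1 then r ^ (-g) else r ^ (-(2 * g))

lemma prof_nonneg (g r : ℝ) (hr : 0 ≤ r) : 0 ≤ prof g r := by
  unfold prof; split_ifs <;> positivity

lemma prof_integrable (n : ℕ) (hn : 3 ≤ n) :
    Integrable (fun u : EuclideanSpace ℝ (Fin n) => prof ((n:ℝ) - 1/2) ‖u‖) := by
  have hn' : (3:ℝ) ≤ n := by exact_mod_cast hn
  have : Nonempty (Fin n) := ⟨⟨0, by omega⟩⟩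
  rw [integrable_fun_norm_addHaar volume (f := prof ((n:ℝ) - 1/2))]
  simp only [finrank_euclideanSpace, Fintype.card_fin, smul_eq_mul]
  rw [← Set.Ioc_union_Ioi_eq_Ioi (zero_le_one' ℝ)]
  have key : ∀ y : ℝ, 0 < y → y ^ (n - 1) = y ^ ((n:ℝ) - 1) := by
    intro y hy
    rw [← Real.rpow_natCast]
    congr 1
    push_cast [Nat.cast_sub (show 1 ≤ n by omega)]
    ring
  refine IntegrableOn.union ?_ ?_
  · have h := (intervalIntegral.intervalIntegrable_rpow' (a := 0) (b := 1)
      (r := -(1/2)) (by norm_num)).1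
    refine h.congr_fun ?_ measurableSet_Ioc
    intro y hy
    simp only [prof, hy.2, if_true]
    rw [key y hy.1, ← Real.rpow_add hy.1]
    congr 1; ring
  · have h := integrableOn_Ioi_rpow_of_lt (a := -(n:ℝ)) (by linarith) zero_lt_one
    refine h.congr_fun ?_ measurableSet_Ioi
    intro y hy
    have hy1 : (1:ℝ) < y := hy
    have hy0 : 0 < y := by linarith
    simp only [prof, not_le.2 hy1, if_false]
    rw [key y hy0, ← Real.rpow_add hy0]
    congr 1; ring

lemma spatial_pt {E : Type*} [NormedAddCommGroup E] [NormedSpace ℝ E] (g : ℝ) (hg : 0 < g)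
    (x y : E) (hxy : x - y ≠ 0) (hy0 : y ≠ 0) :
    ‖x - y‖ ^ (-g) * (1 + ‖y‖) ^ (-g) ≤ 3 ^ g * (1 + ‖x‖) ^ (-(2 * g)) *
      (prof g ‖(1 + ‖x‖)⁻¹ • (x - y)‖ + prof g ‖(1 + ‖x‖)⁻¹ • y‖) := by
  have hx := norm_nonneg x
  have hy := norm_nonneg y
  have hd : 0 < ‖x - y‖ := norm_pos_iff.2 hxy
  have htri : ‖x‖ ≤ ‖x - y‖ + ‖y‖ := by simpa using norm_add_le (x - y) y
  have htri2 : ‖y‖ ≤ ‖x - y‖ + ‖x‖ := by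
    have := norm_sub_le x (x - y); simp at this; linarith
  rw [norm_smul, norm_smul, Real.norm_of_nonneg (by positivity)]
  set R := 1 + ‖x‖ with hR
  set d := ‖x - y‖
  set w := ‖y‖
  have hR0 : 0 < R := by positivity
  have mono : ∀ a b : ℝ, 0 < a → a ≤ b → b ^ (-g) ≤ a ^ (-g) := fun a b ha hab =>
    Real.rpow_le_rpow_of_nonpos ha hab (by linarith)
  have hp1 := prof_nonneg g (R⁻¹ * d) (by positivity)
  have hp2 := prof_nonneg g (R⁻¹ * w) (by positivity)
  have e3 : (R / 3) ^ (-g) = 3 ^ g * R ^ (-g) := by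
    rw [Real.div_rpow hR0.le (by norm_num), Real.rpow_neg (by norm_num : (0:ℝ) ≤ 3)]
    field_simp
  have eR : R ^ (-(2*g)) = R ^ (-g) * R ^ (-g) := by
    rw [← Real.rpow_add hR0]; congr 1; ring
  have sc : ∀ a : ℝ, 0 ≤ a → a ^ (-g) = R ^ (-g) * (R⁻¹ * a) ^ (-g) := by
    intro a ha
    rw [← Real.mul_rpow hR0.le (by positivity)]
    congr 1; field_simp
  have c3 : 0 ≤ 3 ^ g * R ^ (-(2 * g)) := by positivity
  by_cases h1 : d ≤ R / 2
  · have : prof g (R⁻¹ * d) = (R⁻¹ * d) ^ (-g) := by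
      unfold prof; rw [if_pos]; rw [inv_mul_le_iff₀ hR0]; linarith
    calc d ^ (-g) * (1 + w) ^ (-g) ≤ d ^ (-g) * (R / 3) ^ (-g) := by
          gcongr ?_ * ?_; exact mono _ _ (by positivity) (by linarith)
      _ = 3 ^ g * R ^ (-(2 * g)) * prof g (R⁻¹ * d) := by
          rw [e3, this, sc d hd.le, eR]; ring
      _ ≤ _ := by gcongr; linarith
  push Not at h1
  by_cases h2 : w ≤ R
  · have : prof g (R⁻¹ * w) = (R⁻¹ * w) ^ (-g) := by
      unfold prof; rw [if_pos]; rw [inv_mul_le_iff₀ hR0]; linarith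
    have hw : 0 < w := norm_pos_iff.2 hy0
    calc d ^ (-g) * (1 + w) ^ (-g) ≤ (R / 3) ^ (-g) * w ^ (-g) := by
          gcongr ?_ * ?_
          · exact mono _ _ (by positivity) (by linarith)
          · exact mono _ _ (by positivity) (by linarith)
      _ = 3 ^ g * R ^ (-(2 * g)) * prof g (R⁻¹ * w) := by
          rw [e3, this, sc w hy, eR]; ring
      _ ≤ _ := by gcongr; linarith
  push Not at h2
  have hw : 0 < w := by linarith
  have : prof g (R⁻¹ * w) = (R⁻¹ * w) ^ (-g) * (R⁻¹ * w) ^ (-g) := by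
    unfold prof; rw [if_neg]
    · rw [← Real.rpow_add (by positivity)]; congr 1; ring
    · rw [inv_mul_le_iff₀ hR0]; linarith
  have e3' : (w / 3) ^ (-g) = 3 ^ g * w ^ (-g) := by
    rw [Real.div_rpow hw.le (by norm_num), Real.rpow_neg (by norm_num : (0:ℝ) ≤ 3)]
    field_simp
  calc d ^ (-g) * (1 + w) ^ (-g) ≤ (w / 3) ^ (-g) * w ^ (-g) := by
        gcongr ?_ * ?_
        · exact mono _ _ (by positivity) (by linarith)
        · exact mono _ _ (by positivity) (by linarith)
    _ = 3 ^ g * R ^ (-(2 * g)) * prof g (R⁻¹ * w) := by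
        rw [e3', this, sc w hy, eR]; ring
    _ ≤ _ := by gcongr; linarith

lemma time_pt (t s : ℝ) (hs : 0 < s) (hst : s < t) :
    (t - s) ^ (-(1/4) : ℝ) * (1 + s) ^ (-(3/4) : ℝ) ≤
      2 * (t ^ (-(1/4) : ℝ) * s ^ (-(3/4) : ℝ) + t ^ (-(3/4) : ℝ) * (t - s) ^ (-(1/4) : ℝ)) := by
  have ht : 0 < t := by linarith
  have hts : 0 < t - s := by linarith
  have two : ∀ p : ℝ, -1 ≤ p → (t / 2) ^ p ≤ 2 * t ^ p := by
    intro p hp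
    rw [div_eq_inv_mul, Real.mul_rpow (by norm_num) ht.le, Real.inv_rpow (by norm_num),
      ← Real.rpow_neg (by norm_num)]
    gcongr
    calc (2:ℝ) ^ (-p) ≤ 2 ^ (1:ℝ) := Real.rpow_le_rpow_of_exponent_le (by norm_num) (by linarith)
      _ = 2 := by simp
  have p1 : 0 ≤ t ^ (-(1/4) : ℝ) * s ^ (-(3/4) : ℝ) := by positivity
  have p2 : 0 ≤ t ^ (-(3/4) : ℝ) * (t - s) ^ (-(1/4) : ℝ) := by positivity
  by_cases h : s ≤ t / 2
  · calc (t - s) ^ (-(1/4) : ℝ) * (1 + s) ^ (-(3/4) : ℝ)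
        ≤ (2 * t ^ (-(1/4) : ℝ)) * s ^ (-(3/4) : ℝ) := by
          gcongr ?_ * ?_
          · exact (Real.rpow_le_rpow_of_nonpos (by positivity) (by linarith)
              (by norm_num)).trans (two _ (by norm_num))
          · exact Real.rpow_le_rpow_of_nonpos hs (by linarith) (by norm_num)
      _ ≤ _ := by linarith
  · push Not at h
    calc (t - s) ^ (-(1/4) : ℝ) * (1 + s) ^ (-(3/4) : ℝ)
        ≤ (t - s) ^ (-(1/4) : ℝ) * (2 * t ^ (-(3/4) : ℝ)) := by
          gcongr ?_ * ?_
          exact (Real.rpow_le_rpow_of_nonpos (by positivity) (by linarith)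
              (by norm_num)).trans (two _ (by norm_num))
      _ ≤ _ := by linarith

lemma time_int (t : ℝ) (ht : 0 < t) :
    IntervalIntegrable (fun s : ℝ => 2 * (t ^ (-(1/4) : ℝ) * s ^ (-(3/4) : ℝ) +
      t ^ (-(3/4) : ℝ) * (t - s) ^ (-(1/4) : ℝ))) volume 0 t ∧
    ∫ s in (0:ℝ)..t, 2 * (t ^ (-(1/4) : ℝ) * s ^ (-(3/4) : ℝ) +
      t ^ (-(3/4) : ℝ) * (t - s) ^ (-(1/4) : ℝ)) = 32 / 3 := by
  have i1 : IntervalIntegrable (fun s : ℝ => s ^ (-(3/4) : ℝ)) volume 0 t :=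
    intervalIntegral.intervalIntegrable_rpow' (by norm_num)
  have i2 : IntervalIntegrable (fun s : ℝ => (t - s) ^ (-(1/4) : ℝ)) volume 0 t := by
    have := (intervalIntegral.intervalIntegrable_rpow' (a := t) (b := 0)
      (r := -(1/4)) (by norm_num)).comp_sub_left t
    simpa using this
  refine ⟨((i1.const_mul _).add (i2.const_mul _)).const_mul _, ?_⟩
  rw [intervalIntegral.integral_const_mul,
    intervalIntegral.integral_add (i1.const_mul _) (i2.const_mul _),
    intervalIntegral.integral_const_mul, intervalIntegral.integral_const_mul,
    intervalIntegral.integral_comp_sub_left (fun s : ℝ => s ^ (-(1/4) : ℝ)),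
    integral_rpow (by norm_num), integral_rpow (by norm_num)]
  have a1 : t ^ (-(1/4) : ℝ) * t ^ (-(3/4) + 1 : ℝ) = 1 := by
    rw [← Real.rpow_add ht]; norm_num
  have a2 : t ^ (-(3/4) : ℝ) * t ^ (-(1/4) + 1 : ℝ) = 1 := by
    rw [← Real.rpow_add ht]; norm_num
  have z1 : (0:ℝ) ^ (-(3/4) + 1 : ℝ) = 0 := Real.zero_rpow (by norm_num)
  have z2 : (0:ℝ) ^ (-(1/4) + 1 : ℝ) = 0 := Real.zero_rpow (by norm_num)
  simp only [sub_self, sub_zero, z1, z2]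
  rw [← mul_div_assoc, ← mul_div_assoc, a1, a2]
  norm_num

lemma spatial_int (n : ℕ) (hn : 3 ≤ n) (x : EuclideanSpace ℝ (Fin n)) :
    Integrable (fun y : EuclideanSpace ℝ (Fin n) =>
      3 ^ ((n:ℝ) - 1/2) * (1 + ‖x‖) ^ (-(2 * ((n:ℝ) - 1/2))) *
      (prof ((n:ℝ) - 1/2) ‖(1 + ‖x‖)⁻¹ • (x - y)‖ + prof ((n:ℝ) - 1/2) ‖(1 + ‖x‖)⁻¹ • y‖)) ∧
    ∫ y : EuclideanSpace ℝ (Fin n),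
      3 ^ ((n:ℝ) - 1/2) * (1 + ‖x‖) ^ (-(2 * ((n:ℝ) - 1/2))) *
      (prof ((n:ℝ) - 1/2) ‖(1 + ‖x‖)⁻¹ • (x - y)‖ + prof ((n:ℝ) - 1/2) ‖(1 + ‖x‖)⁻¹ • y‖) =
    (3 ^ ((n:ℝ) - 1/2) * (2 * ∫ u : EuclideanSpace ℝ (Fin n), prof ((n:ℝ) - 1/2) ‖u‖)) *
      (1 + ‖x‖) ^ (-((n:ℝ) - 1)) := by
  have hR0 : 0 < 1 + ‖x‖ := by positivity
  set R := 1 + ‖x‖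
  set g := (n:ℝ) - 1/2 with hg
  have i2 : Integrable (fun y : EuclideanSpace ℝ (Fin n) => prof g ‖R⁻¹ • y‖) :=
    (prof_integrable n hn).comp_smul (inv_ne_zero hR0.ne')
  have i1 : Integrable (fun y : EuclideanSpace ℝ (Fin n) => prof g ‖R⁻¹ • (x - y)‖) :=
    i2.comp_sub_left x
  refine ⟨(i1.add i2).const_mul _, ?_⟩
  rw [integral_const_mul, integral_add i1 i2,
    integral_sub_left_eq_self (fun y : EuclideanSpace ℝ (Fin n) => prof g ‖R⁻¹ • y‖) volume x,
    Measure.integral_comp_inv_smul_of_nonneg volume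
      (fun y : EuclideanSpace ℝ (Fin n) => prof g ‖y‖) hR0.le]
  simp only [finrank_euclideanSpace, Fintype.card_fin, smul_eq_mul]
  have : R ^ (-((n:ℝ) - 1)) = R ^ (-(2 * g)) * R ^ n := by
    rw [← Real.rpow_natCast, ← Real.rpow_add hR0]
    congr 1; rw [hg]; ring
  rw [this]; ring

/-- Spatial decay of the spacetime convolution: if `|K(x,t)| ≤ C|x|^{-α}t^{-β/2}` for all
`α, β ≥ 0` with `α + β = n`, and `|G(y,s)| ≤ C(1+|y|)^{-a}(1+s)^{-b/2}` for all `a, b ≥ 0` with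
`a + b = n + 1` (`n ≥ 3`), then for `ε ∈ (0,1)` the convolution
`I(x,t) = ∫₀ᵗ∫ K(x-y,t-s)G(y,s) dy ds` satisfies `|I(x,t)| ≤ C'(1+|x|)^{-(n-1)}` uniformly in
`t > 0`, with `C'` depending only on `C, n, ε`. -/
theorem stmt12 (n : ℕ) (hn : 3 ≤ n) (C ε : ℝ) (hC : 0 < C) (hε : ε ∈ Set.Ioo (0:ℝ) 1) :
    ∃ C' > 0, ∀ (K : EuclideanSpace ℝ (Fin n) → ℝ → ℝ)
      (G : EuclideanSpace ℝ (Fin n) → ℝ → ℝ),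
      (∀ α β : ℝ, 0 ≤ α → 0 ≤ β → α + β = (n : ℝ) →
        ∀ (x : EuclideanSpace ℝ (Fin n)) (t : ℝ), x ≠ 0 → 0 < t →
          |K x t| ≤ C * ‖x‖ ^ (-α) * t ^ (-β / 2)) →
      (∀ a b : ℝ, 0 ≤ a → 0 ≤ b → a + b = (n : ℝ) + 1 →
        ∀ (y : EuclideanSpace ℝ (Fin n)) (s : ℝ), 0 < s →
          |G y s| ≤ C * (1 + ‖y‖) ^ (-a) * (1 + s) ^ (-b / 2)) →
      ∀ (x : EuclideanSpace ℝ (Fin n)) (t : ℝ), 0 < t →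
        |∫ s in (0:ℝ)..t, ∫ y : EuclideanSpace ℝ (Fin n), K (x - y) (t - s) * G y s|
          ≤ C' * (1 + ‖x‖) ^ (-((n : ℝ) - 1)) := by
  
  have hn' : (3:ℝ) ≤ n := by exact_mod_cast hn
  have : Nontrivial (EuclideanSpace ℝ (Fin n)) := by
    have : Nonempty (Fin n) := ⟨⟨0, by omega⟩⟩
    infer_instance
  set A : ℝ := 3 ^ ((n:ℝ) - 1/2) *
    (2 * ∫ u : EuclideanSpace ℝ (Fin n), prof ((n:ℝ) - 1/2) ‖u‖) with hA
  have hA0 : 0 ≤ A := by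
    have : 0 ≤ ∫ u : EuclideanSpace ℝ (Fin n), prof ((n:ℝ) - 1/2) ‖u‖ :=
      integral_nonneg fun u => prof_nonneg _ _ (norm_nonneg u)
    positivity
  refine ⟨C ^ 2 * A * (32 / 3) + 1, by positivity, ?_⟩
  intro K G hK hG x t ht
  obtain ⟨hSi, hSe⟩ := spatial_int n hn x
  obtain ⟨hTi, hTe⟩ := time_int t ht
  rw [← hA] at hSe
  set g := (n:ℝ) - 1/2 with hg
  set B := (1 + ‖x‖) ^ (-((n:ℝ) - 1)) with hB
  have hB0 : 0 ≤ B := by positivity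
  have inner : ∀ s : ℝ, 0 < s → s < t →
      ‖∫ y : EuclideanSpace ℝ (Fin n), K (x - y) (t - s) * G y s‖ ≤
        (C ^ 2 * (A * B)) * (2 * (t ^ (-(1/4) : ℝ) * s ^ (-(3/4) : ℝ) +
          t ^ (-(3/4) : ℝ) * (t - s) ^ (-(1/4) : ℝ))) := by
    intro s hs hst
    have hts : 0 < t - s := by linarith
    refine le_trans (norm_integral_le_of_norm_le
      (hSi.const_mul (C ^ 2 * ((t - s) ^ (-(1/4) : ℝ) * (1 + s) ^ (-(3/4) : ℝ)))) ?_) ?_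
    · filter_upwards [Measure.ae_ne volume x,
        Measure.ae_ne volume (0 : EuclideanSpace ℝ (Fin n))] with y hyx hy0
      have hxy : x - y ≠ 0 := sub_ne_zero.2 (Ne.symm hyx)
      have k := hK g (1/2) (by rw [hg]; linarith) (by norm_num) (by rw [hg]; ring) (x - y) (t - s)
        hxy hts
      have l := hG g (3/2) (by rw [hg]; linarith) (by norm_num) (by rw [hg]; ring) y s hs
      have e1 : (-(1/2) / 2 : ℝ) = -(1/4) := by norm_num
      have e2 : (-(3/2) / 2 : ℝ) = -(3/4) := by norm_num
      rw [e1] at k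
      rw [e2] at l
      have sp := spatial_pt g (by rw [hg]; linarith) x y hxy hy0
      rw [norm_mul, Real.norm_eq_abs, Real.norm_eq_abs]
      calc |K (x - y) (t - s)| * |G y s| ≤
          (C * ‖x - y‖ ^ (-g) * (t - s) ^ (-(1/4) : ℝ)) *
            (C * (1 + ‖y‖) ^ (-g) * (1 + s) ^ (-(3/4) : ℝ)) := by gcongr
        _ = C ^ 2 * ((t - s) ^ (-(1/4) : ℝ) * (1 + s) ^ (-(3/4) : ℝ)) *
            (‖x - y‖ ^ (-g) * (1 + ‖y‖) ^ (-g)) := by ring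
        _ ≤ _ := by gcongr
    · rw [integral_const_mul, hSe]
      calc C ^ 2 * ((t - s) ^ (-(1/4) : ℝ) * (1 + s) ^ (-(3/4) : ℝ)) * (A * B)
          = (C ^ 2 * (A * B)) * ((t - s) ^ (-(1/4) : ℝ) * (1 + s) ^ (-(3/4) : ℝ)) := by ring
        _ ≤ _ := mul_le_mul_of_nonneg_left (time_pt t s hs hst) (by positivity)
  rw [← Real.norm_eq_abs]
  refine le_trans (intervalIntegral.norm_integral_le_of_norm_le ht.le ?_
    (hTi.const_mul (C ^ 2 * (A * B)))) ?_
  · filter_upwards [Measure.ae_ne volume t] with s hs hs'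
    exact inner s hs'.1 (lt_of_le_of_ne hs'.2 hs)
  · rw [intervalIntegral.integral_const_mul, hTe]
    nlinarith
end

section
/- Let n ≥ 3 and ε ∈ (0,1). Let K and G be as follows: |K(x,t)| ≤ C|x|^{-α}t^{-β/2} for all α+β = n (α,β ≥ 0), and G(·,s) supported in the fixed ball B_R with |G(y,s)| ≤ C(1+|y|)^{-a}(1+s)^{-b/2} for all a+b = n+1 (a,b ≥ 0). Then I(x,t) = ∫₀ᵗ∫ K(x-y,t-s)G(y,s) dy ds satisfies the temporal bound |I(x,t)| ≤ C'(1+t)^{-(n-1-ε)/2} uniformly in x, with C' depending only on C, n, ε, R. -/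
open MeasureTheory Metric

lemma aux_h (n : ℕ) (hn : 3 ≤ n) :
    Integrable (fun z : EuclideanSpace ℝ (Fin n) =>
      (Set.Iio (1:ℝ)).indicator (fun r : ℝ => r ^ (-((n:ℝ) - 1))) ‖z‖) := by
  haveI : Nonempty (Fin n) := ⟨⟨0, by omega⟩⟩
  rw [integrable_fun_norm_addHaar volume]
  rw [finrank_euclideanSpace_fin]
  have : IntegrableOn (fun y : ℝ => (Set.Iio (1:ℝ)).indicator (fun _ => (1:ℝ)) y) (Set.Ioi 0) := by
    rw [integrableOn_indicator_iff measurableSet_Iio, Set.Iio_inter_Ioi]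
    exact integrableOn_const (by simp)
  refine this.congr_fun ?_ measurableSet_Ioi
  intro y hy
  have hy : 0 < y := hy
  simp only [Set.indicator]
  split_ifs
  · rw [smul_eq_mul, ← Real.rpow_natCast, ← Real.rpow_add hy]
    push_cast [Nat.cast_sub (show 1 ≤ n by omega)]
    simp
  · simp

lemma aux_g1 (ε : ℝ) (hε : 0 < ε) :
    Integrable ((Set.Ioi (0:ℝ)).indicator (fun s : ℝ => (1 + s) ^ (-1 - ε / 2))) := by
  rw [integrable_indicator_iff measurableSet_Ioi]
  have := integrableOn_add_rpow_Ioi_of_lt (a := -1 - ε/2) (c := 0) (m := 1) (by linarith) (by simp)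
  simpa [add_comm] using this

lemma aux_g2 :
    Integrable ((Set.Ioc (0:ℝ) 1).indicator (fun s : ℝ => s ^ (-1 / 2 : ℝ))) := by
  rw [integrable_indicator_iff measurableSet_Ioc,
    ← intervalIntegrable_iff_integrableOn_Ioc_of_le zero_le_one]
  exact intervalIntegral.intervalIntegrable_rpow' (by norm_num)

lemma aux_time (n : ℕ) (hn : 3 ≤ n) (ε : ℝ) (hε : ε ∈ Set.Ioo (0:ℝ) 1) (t s : ℝ)
    (hs : 0 < s) (hst : s < t) :
    (1 + s) ^ (-((n:ℝ) + 1) / 2) *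
      (if 1 < t - s then (t - s) ^ (-(n:ℝ) / 2) else (t - s) ^ (-1 / 2 : ℝ)) ≤
    2 ^ (((n:ℝ) - 1 - ε) / 2) * (1 + t) ^ (-((n:ℝ) - 1 - ε) / 2) *
      ((Set.Ioi (0:ℝ)).indicator (fun s : ℝ => (1 + s) ^ (-1 - ε / 2)) s +
       (Set.Ioc (0:ℝ) 1).indicator (fun s : ℝ => s ^ (-1 / 2 : ℝ)) (t - s)) := by
  obtain ⟨h0, h1⟩ := hε
  have hn' : (3:ℝ) ≤ n := by exact_mod_cast hn
  set τ := t - s with hτ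
  have hτ0 : 0 < τ := by linarith
  set p := ((n:ℝ) - 1 - ε) / 2 with hp
  have hp0 : 0 ≤ p := by rw [hp]; linarith
  have e1 : -((n:ℝ) - 1 - ε) / 2 = -p := by rw [hp]; ring
  have key : (1 + s) ^ (-p) * (1 + τ) ^ (-p) ≤ (1 + t) ^ (-p) := by
    rw [← Real.mul_rpow (by linarith) (by linarith)]
    apply Real.rpow_le_rpow_of_nonpos (by linarith) _ (by linarith)
    have := mul_pos hs hτ0
    nlinarith
  have hs1 : (1 + s) ^ (-((n:ℝ) + 1) / 2) = (1 + s) ^ (-p) * (1 + s) ^ (-1 - ε / 2) := by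
    rw [← Real.rpow_add (by linarith)]; congr 1; rw [hp]; ring
  have hind : (Set.Ioi (0:ℝ)).indicator (fun s : ℝ => (1 + s) ^ (-1 - ε / 2)) s
      = (1 + s) ^ (-1 - ε / 2) := Set.indicator_of_mem (by exact hs) _
  have two : (2:ℝ) ^ p * 2 ^ (-p) = 1 := by
    rw [← Real.rpow_add (by norm_num)]; simp
  have q0 : 0 ≤ (1 + s) ^ (-1 - ε / 2) := by positivity
  have a0 : 0 ≤ (1 + s) ^ (-p) := by positivity
  have b0 : (0:ℝ) ≤ 2 ^ p := by positivity
  rw [e1, hs1, hind]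
  split_ifs with h
  · have : (Set.Ioc (0:ℝ) 1).indicator (fun s : ℝ => s ^ (-1 / 2 : ℝ)) τ = 0 :=
      Set.indicator_of_notMem (fun hh => by linarith [hh.2]) _
    rw [this, add_zero]
    have k1 : τ ^ (-(n:ℝ) / 2) ≤ 2 ^ p * (1 + τ) ^ (-p) := by
      calc τ ^ (-(n:ℝ) / 2) ≤ τ ^ (-p) :=
            Real.rpow_le_rpow_of_exponent_le h.le (by rw [hp]; linarith)
        _ = 2 ^ p * (2 * τ) ^ (-p) := by
            rw [Real.mul_rpow (by norm_num) hτ0.le, ← mul_assoc, two, one_mul]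
        _ ≤ _ := by
            apply mul_le_mul_of_nonneg_left _ b0
            exact Real.rpow_le_rpow_of_nonpos (by linarith) (by linarith) (by linarith)
    calc _ ≤ (1 + s) ^ (-p) * (1 + s) ^ (-1 - ε / 2) * (2 ^ p * (1 + τ) ^ (-p)) := by gcongr
      _ = 2 ^ p * ((1 + s) ^ (-p) * (1 + τ) ^ (-p)) * (1 + s) ^ (-1 - ε / 2) := by ring
      _ ≤ _ := by gcongr
  · have : (Set.Ioc (0:ℝ) 1).indicator (fun s : ℝ => s ^ (-1 / 2 : ℝ)) τ = τ ^ (-1 / 2 : ℝ) :=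
      Set.indicator_of_mem (Set.mem_Ioc.2 ⟨hτ0, not_lt.1 h⟩) _
    rw [this]
    have r0 : 0 ≤ τ ^ (-1 / 2 : ℝ) := by positivity
    have k1 : 1 ≤ 2 ^ p * (1 + τ) ^ (-p) := by
      rw [← two]
      apply mul_le_mul_of_nonneg_left _ b0
      exact Real.rpow_le_rpow_of_nonpos (by linarith) (by linarith) (by linarith)
    have k2 : (1 + s) ^ (-1 - ε / 2) ≤ 1 :=
      Real.rpow_le_one_of_one_le_of_nonpos (by linarith) (by linarith)
    calc (1 + s) ^ (-p) * (1 + s) ^ (-1 - ε / 2) * τ ^ (-1 / 2 : ℝ)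
        ≤ (1 + s) ^ (-p) * 1 * τ ^ (-1 / 2 : ℝ) := by gcongr
      _ ≤ (1 + s) ^ (-p) * (2 ^ p * (1 + τ) ^ (-p)) * τ ^ (-1 / 2 : ℝ) := by gcongr
      _ = 2 ^ p * ((1 + s) ^ (-p) * (1 + τ) ^ (-p)) * τ ^ (-1 / 2 : ℝ) := by ring
      _ ≤ 2 ^ p * (1 + t) ^ (-p) * τ ^ (-1 / 2 : ℝ) := by gcongr
      _ ≤ _ := by
        apply mul_le_mul_of_nonneg_left _ (by have : 0 < 1 + t := by linarith
                                              positivity)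
        linarith

/-- Temporal decay of the spacetime convolution: if `|K(x,t)| ≤ C|x|^{-α}t^{-β/2}` for all
`α, β ≥ 0` with `α + β = n`, and `G(·,s)` is supported in the ball `B_R` with
`|G(y,s)| ≤ C(1+|y|)^{-a}(1+s)^{-b/2}` for all `a, b ≥ 0` with `a + b = n + 1` (`n ≥ 3`), then
for `ε ∈ (0,1)`, `I(x,t) = ∫₀ᵗ∫ K(x-y,t-s)G(y,s) dy ds` satisfies
`|I(x,t)| ≤ C'(1+t)^{-(n-1-ε)/2}` uniformly in `x`, with `C'` depending on `C, n, ε, R`. -/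
theorem stmt13 (n : ℕ) (hn : 3 ≤ n) (C ε R : ℝ) (hC : 0 < C) (hε : ε ∈ Set.Ioo (0:ℝ) 1)
    (hR : 0 < R) :
    ∃ C' > 0, ∀ (K : EuclideanSpace ℝ (Fin n) → ℝ → ℝ)
      (G : EuclideanSpace ℝ (Fin n) → ℝ → ℝ),
      (∀ α β : ℝ, 0 ≤ α → 0 ≤ β → α + β = (n : ℝ) →
        ∀ (x : EuclideanSpace ℝ (Fin n)) (t : ℝ), x ≠ 0 → 0 < t →
          |K x t| ≤ C * ‖x‖ ^ (-α) * t ^ (-β / 2)) →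
      (∀ (s : ℝ) (y : EuclideanSpace ℝ (Fin n)), y ∉ ball (0 : EuclideanSpace ℝ (Fin n)) R →
        G y s = 0) →
      (∀ a b : ℝ, 0 ≤ a → 0 ≤ b → a + b = (n : ℝ) + 1 →
        ∀ (y : EuclideanSpace ℝ (Fin n)) (s : ℝ), 0 < s →
          |G y s| ≤ C * (1 + ‖y‖) ^ (-a) * (1 + s) ^ (-b / 2)) →
      ∀ (x : EuclideanSpace ℝ (Fin n)) (t : ℝ), 0 < t →
        |∫ s in (0:ℝ)..t, ∫ y : EuclideanSpace ℝ (Fin n), K (x - y) (t - s) * G y s|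
          ≤ C' * (1 + t) ^ (-((n : ℝ) - 1 - ε) / 2) := by
  haveI : Nonempty (Fin n) := ⟨⟨0, by omega⟩⟩
  have hn' : (3:ℝ) ≤ n := by exact_mod_cast hn
  set h : EuclideanSpace ℝ (Fin n) → ℝ := fun z =>
      (Set.Iio (1:ℝ)).indicator (fun r : ℝ => r ^ (-((n:ℝ) - 1))) ‖z‖ with hh
  have hint : Integrable h := aux_h n hn
  have hpos : ∀ z, 0 ≤ h z := fun z => by
    simp only [hh, Set.indicator]
    split_ifs <;> positivity
  set bR : EuclideanSpace ℝ (Fin n) → ℝ :=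
    (ball (0 : EuclideanSpace ℝ (Fin n)) R).indicator (fun _ => (1:ℝ)) with hbR
  have bint : Integrable bR := by
    rw [hbR, integrable_indicator_iff measurableSet_ball]
    exact integrableOn_const measure_ball_lt_top.ne
  have bpos : ∀ z, 0 ≤ bR z := fun z => Set.indicator_nonneg (fun _ _ => zero_le_one) _
  set g1 := (Set.Ioi (0:ℝ)).indicator (fun s : ℝ => (1 + s) ^ (-1 - ε / 2)) with hg1
  set g2 := (Set.Ioc (0:ℝ) 1).indicator (fun s : ℝ => s ^ (-1 / 2 : ℝ)) with hg2
  have g1int : Integrable g1 := aux_g1 ε hε.1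
  have g2int : Integrable g2 := aux_g2
  have g1pos : ∀ s, 0 ≤ g1 s := fun s => Set.indicator_nonneg (fun s hs => by
    have : (0:ℝ) < s := hs
    positivity) _
  have g2pos : ∀ s, 0 ≤ g2 s := fun s => Set.indicator_nonneg (fun s hs => by
    have : (0:ℝ) < s := hs.1
    positivity) _
  set M := (∫ z, h z) + ∫ z, bR z with hM
  have M0 : 0 ≤ M := add_nonneg (integral_nonneg hpos) (integral_nonneg bpos)
  set N := (∫ z, g1 z) + ∫ z, g2 z with hN
  have N0 : 0 ≤ N := add_nonneg (integral_nonneg g1pos) (integral_nonneg g2pos)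
  set P : ℝ := 2 ^ (((n:ℝ) - 1 - ε) / 2) with hP
  have P0 : 0 < P := by positivity
  refine ⟨C * C * M * P * N + 1, by positivity, ?_⟩
  intro K G hK hsupp hG x t ht
  -- inner bound
  have inner : ∀ s, 0 < s → s < t →
      ‖∫ y : EuclideanSpace ℝ (Fin n), K (x - y) (t - s) * G y s‖ ≤
        C * C * M * P * (1 + t) ^ (-((n : ℝ) - 1 - ε) / 2) * (g1 s + g2 (t - s)) := by
    intro s hs hst
    have hτ : 0 < t - s := by linarith
    set Φ : ℝ := (if 1 < t - s then (t - s) ^ (-(n:ℝ) / 2) else (t - s) ^ (-1 / 2 : ℝ)) with hΦ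
    have Φ0 : 0 ≤ Φ := by rw [hΦ]; split_ifs <;> positivity
    set S : ℝ := (1 + s) ^ (-((n:ℝ) + 1) / 2) with hS
    have S0 : 0 ≤ S := by rw [hS]; positivity
    have hKb : ∀ z : EuclideanSpace ℝ (Fin n), z ≠ 0 → |K z (t - s)| ≤ C * Φ * (h z + 1) := by
      intro z hz
      have hz' : 0 < ‖z‖ := norm_pos_iff.2 hz
      have hz1 := hpos z
      rw [hΦ]
      split_ifs with hc
      · have := hK 0 n le_rfl (by linarith) (by ring) z (t - s) hz hτ
        rw [neg_zero, Real.rpow_zero, mul_one] at this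
        refine this.trans ?_
        exact le_mul_of_one_le_right (by positivity) (by linarith)
      · have := hK (n - 1) 1 (by linarith) (by norm_num) (by ring) z (t - s) hz hτ
        refine this.trans ?_
        rw [mul_right_comm]
        apply mul_le_mul_of_nonneg_left _ (by positivity)
        by_cases hz2 : ‖z‖ < 1
        · have : h z = ‖z‖ ^ (-((n:ℝ) - 1)) := Set.indicator_of_mem (by exact hz2) _
          linarith
        · have : ‖z‖ ^ (-((n:ℝ) - 1)) ≤ 1 :=
            Real.rpow_le_one_of_one_le_of_nonpos (not_lt.1 hz2) (by linarith)
          linarith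
    have hGb : ∀ y, |G y s| ≤ C * S := by
      intro y
      have := hG 0 (n + 1) le_rfl (by linarith) (by ring) y s hs
      rwa [neg_zero, Real.rpow_zero, mul_one] at this
    have step : ‖∫ y : EuclideanSpace ℝ (Fin n), K (x - y) (t - s) * G y s‖ ≤
        ∫ y, C * C * (S * Φ) * (h (x - y) + bR y) := by
      apply norm_integral_le_of_norm_le
      · exact ((hint.comp_sub_left x).add bint).const_mul _
      · have : ∀ᵐ y : EuclideanSpace ℝ (Fin n), y ≠ x := by
          simp [ae_iff]
        filter_upwards [this] with y hy
        have hy' : x - y ≠ 0 := sub_ne_zero.2 hy.symm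
        have h1 := hpos (x - y)
        by_cases hyR : y ∈ ball (0 : EuclideanSpace ℝ (Fin n)) R
        · have hb : bR y = 1 := Set.indicator_of_mem hyR _
          rw [hb, norm_mul, Real.norm_eq_abs, Real.norm_eq_abs]
          calc _ ≤ (C * Φ * (h (x - y) + 1)) * (C * S) := by
                gcongr
                · exact hKb _ hy'
                · exact hGb y
            _ = _ := by ring
        · rw [hsupp s y hyR]
          have := bpos y
          rw [mul_zero, norm_zero]
          positivity
    rw [integral_const_mul, integral_add (hint.comp_sub_left x) bint,
      integral_sub_left_eq_self h volume x] at step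
    refine step.trans ?_
    have T := aux_time n hn ε hε t s hs hst
    calc C * C * (S * Φ) * M = C * C * M * (S * Φ) := by ring
      _ ≤ C * C * M * (P * (1 + t) ^ (-((n : ℝ) - 1 - ε) / 2) * (g1 s + g2 (t - s))) := by
        apply mul_le_mul_of_nonneg_left T (by positivity)
      _ = _ := by ring
  have gint : Integrable (fun s =>
      C * C * M * P * (1 + t) ^ (-((n : ℝ) - 1 - ε) / 2) * (g1 s + g2 (t - s))) :=
    (g1int.add (g2int.comp_sub_left t)).const_mul _
  have D0 : 0 ≤ (1 + t) ^ (-((n : ℝ) - 1 - ε) / 2) := by positivity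
  rw [intervalIntegral.integral_of_le ht.le, ← Real.norm_eq_abs]
  calc _ ≤ ∫ s in Set.Ioc 0 t,
        C * C * M * P * (1 + t) ^ (-((n : ℝ) - 1 - ε) / 2) * (g1 s + g2 (t - s)) := by
        apply norm_integral_le_of_norm_le gint.integrableOn
        have : ∀ᵐ s : ℝ, s ≠ t := by simp [ae_iff]
        filter_upwards [ae_restrict_mem measurableSet_Ioc, ae_restrict_of_ae this] with s hs hne
        exact inner s hs.1 (lt_of_le_of_ne hs.2 hne)
    _ ≤ ∫ s, C * C * M * P * (1 + t) ^ (-((n : ℝ) - 1 - ε) / 2) * (g1 s + g2 (t - s)) := by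
        apply setIntegral_le_integral gint
        filter_upwards with s
        have := g1pos s
        have := g2pos (t - s)
        simp only [Pi.zero_apply]
        positivity
    _ = C * C * M * P * N * (1 + t) ^ (-((n : ℝ) - 1 - ε) / 2) := by
        rw [integral_const_mul, integral_add g1int (g2int.comp_sub_left t),
          integral_sub_left_eq_self g2 volume t]
        ring
    _ ≤ _ := by
        apply mul_le_mul_of_nonneg_right _ D0
        linarith
end
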